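/- Let C be a well-powered category with pullbacks, images, coproducts, and an initial object all of whose initial morphisms are monomorphisms (InitialMonoClass). Let B be an object, a = (r, i, i₀, p) a reaction over B, t a subobject of B, and f : B ⟶ B' a monomorphism. Then the result of a on t is mapped by f to the result of the image reaction f(a) on map f t: (Subobject.map f) (res_a(t)) = res_{f(a)}((Subobject.map f) t), i.e. (Subobject.map f) (if r ≤ t ∧ t ⊓ i ≤ i₀ then p else ⊥) = (if (Subobject.map f) r ≤ (Subobject.map f) t ∧ (Subobject.map f) t ⊓ (Subobject.map f) i ≤ (Subobject.map f) i₀ then (Subobject.map f) p else ⊥). -/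

import Mathlib

open CategoryTheory CategoryTheory.Limits

universe v u

/-- A reaction over a background object `B`: reactant `r`, inhibitor pair `(i, i₀)`,
and product `p`, all subobjects of `B`. -/
structure Reaction {C : Type u} [Category.{v} C] (B : C) where
  r : Subobject B
  i : Subobject B
  i₀ : Subobject B
  p : Subobject B

/-- A reaction `a` is enabled on a state `t` iff `r ≤ t` and `t ⊓ i ≤ i₀`. -/
def Reaction.enabled {C : Type u} [Category.{v} C] [HasPullbacks C] {B : C}
    (a : Reaction B) (t : Subobject B) : Prop :=
  a.r ≤ t ∧ t ⊓ a.i ≤ a.i₀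

open Classical in
/-- The result of a reaction `a` on a state `t`: the product `p` if `a` is enabled
on `t`, and the empty subobject `⊥` otherwise. -/
noncomputable def Reaction.res {C : Type u} [Category.{v} C] [HasPullbacks C]
    [HasInitial C] [InitialMonoClass C] {B : C}
    (a : Reaction B) (t : Subobject B) : Subobject B :=
  if a.enabled t then a.p else ⊥

/-- The image reaction `f(a)` of a reaction `a` along a monomorphism `f` on the
background. -/
def Reaction.map {C : Type u} [Category.{v} C] {B B' : C}
    (f : B ⟶ B') [Mono f] (a : Reaction B) : Reaction B' :=
  ⟨(Subobject.map f).obj a.r, (Subobject.map f).obj a.i,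
    (Subobject.map f).obj a.i₀, (Subobject.map f).obj a.p⟩

/-- Postcomposition with a monomorphism reflects and preserves the order on subobjects. -/
theorem CategoryTheory.Subobject.map_obj_le_map_obj_iff {C : Type u} [Category.{v} C]
    [HasPullbacks C] {X Y : C} (f : X ⟶ Y) [Mono f] {s t : Subobject X} :
    (Subobject.map f).obj s ≤ (Subobject.map f).obj t ↔ s ≤ t := by
  refine ⟨fun h => ?_, fun h => (Subobject.map f).monotone h⟩
  simpa only [Subobject.pullback_map_self] using (Subobject.pullback f).monotone h

/-- The image reaction is enabled on the image of exactly the states enabling the reaction. -/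
theorem Reaction.enabled_map_iff {C : Type u} [Category.{v} C] [HasPullbacks C] {B B' : C}
    (f : B ⟶ B') [Mono f] (a : Reaction B) (t : Subobject B) :
    (a.map f).enabled ((Subobject.map f).obj t) ↔ a.enabled t := by
  simp only [Reaction.enabled, Reaction.map, ← Subobject.inf_map,
    Subobject.map_obj_le_map_obj_iff]

/-- Theorem 5.1.2: `f ∘ res_a(t) = res_{f(a)}(f ∘ t)` for a monomorphism `f` on the
background. -/
theorem reaction_map_res
    {C : Type u} [Category.{v} C] [WellPowered.{v} C]
    [HasPullbacks C] [HasImages C] [HasCoproducts.{v} C]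
    [HasInitial C] [InitialMonoClass C]
    {B B' : C} (f : B ⟶ B') [Mono f] (a : Reaction B) (t : Subobject B) :
    (Subobject.map f).obj (a.res t) = (a.map f).res ((Subobject.map f).obj t) := by
  by_cases h : a.enabled t
  · rw [Reaction.res, Reaction.res, if_pos h, if_pos ((a.enabled_map_iff f t).2 h)]
    rfl
  · rw [Reaction.res, Reaction.res, if_neg h, if_neg (mt (a.enabled_map_iff f t).1 h),
      Subobject.map_bot]
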